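/- arXiv:1103.0089 — 8 statements merged into one kernel-verified Lean document; each statement's English description precedes it below -/
import Mathlib

section
/- Let W be an invertible lower triangular n×n complex matrix and let Λ be an invertible diagonal n×n complex matrix. If W·Λ·Wᴴ is a diagonal matrix, where Wᴴ denotes the conjugate transpose of W, then W is a diagonal matrix. -/
open Matrix

/-- If `W` is an invertible lower triangular matrix, `Λ` is an invertible diagonal
matrix, and `W * Λ * Wᴴ` is diagonal, then `W` is diagonal. -/
theorem stmt_1 {n : ℕ} (W Λ : Matrix (Fin n) (Fin n) ℂ)
    (hWinv : IsUnit W)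
    (hW : ∀ i j : Fin n, i < j → W i j = 0)
    (hΛdiag : Λ.IsDiag) (hΛinv : IsUnit Λ)
    (hdiag : (W * Λ * Wᴴ).IsDiag) :
    W.IsDiag := by
  have hWd : ∀ j, W j j ≠ 0 := by
    have h1 := (Matrix.isUnit_iff_isUnit_det W).1 hWinv
    rw [Matrix.det_of_lowerTriangular W (fun i j h => hW i j h)] at h1
    intro j
    exact Finset.prod_ne_zero_iff.1 h1.ne_zero j (Finset.mem_univ j)
  have hΛd : ∀ j, Λ j j ≠ 0 := by
    have h1 := (Matrix.isUnit_iff_isUnit_det Λ).1 hΛinv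
    rw [Matrix.det_of_lowerTriangular Λ
      (fun i j h => hΛdiag (ne_of_lt (show i < j from h)))] at h1
    intro j
    exact Finset.prod_ne_zero_iff.1 h1.ne_zero j (Finset.mem_univ j)
  have hmul : ∀ i k, (W * Λ) i k = W i k * Λ k k := by
    intro i k
    rw [Matrix.mul_apply]
    apply Finset.sum_eq_single k
    · intro l _ hl
      rw [hΛdiag hl, mul_zero]
    · intro h
      exact absurd (Finset.mem_univ k) h
  have key : ∀ j i : Fin n, j < i → W i j = 0 := by
    intro j
    induction j using WellFoundedLT.induction with
    | ind j ih =>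
      intro i hij
      have h : (W * Λ * Wᴴ) i j = 0 := hdiag (ne_of_gt hij)
      rw [Matrix.mul_apply, Finset.sum_eq_single j] at h
      · rw [hmul, Matrix.conjTranspose_apply] at h
        have h2 : star (W j j) ≠ 0 := star_ne_zero.2 (hWd j)
        simpa [hΛd j, hWd j] using h
      · intro k _ hk
        rw [hmul, Matrix.conjTranspose_apply]
        rcases lt_or_gt_of_ne hk with hlt | hgt
        · rw [ih k hlt i (hlt.trans hij)]
          simp
        · rw [hW j k hgt]
          simp
      · intro hh
        exact absurd (Finset.mem_univ j) hh
  intro i j hij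
  rcases lt_or_gt_of_ne hij with hlt | hgt
  · exact hW i j hlt
  · exact key j i hgt
end

section
/- Let n be a natural number, let C and D be arbitrary n×n complex matrices, and let Ψ be an invertible n×n complex matrix. Then the determinant of the 2n×2n block matrix with blocks [[C + Ψ, Ψ], [Ψ, D + Ψ]] equals det(Ψ) · det(C·Ψ⁻¹·D + C + D). -/
open Matrix

/-- Appendix A determinant identity (Eqn. (cf2)):
`det [[C+Ψ, Ψ], [Ψ, D+Ψ]] = det Ψ · det (C·Ψ⁻¹·D + C + D)` for invertible `Ψ`. -/
theorem stmt_4 {n : ℕ} (C D Ψ : Matrix (Fin n) (Fin n) ℂ) (hΨ : IsUnit Ψ) :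
    (Matrix.fromBlocks (C + Ψ) Ψ Ψ (D + Ψ)).det =
      Ψ.det * (C * Ψ⁻¹ * D + C + D).det := by
  have hdet : IsUnit Ψ.det := (Matrix.isUnit_iff_isUnit_det Ψ).1 hΨ
  have hcancel : Ψ * (Ψ⁻¹ * D) = D := by
    rw [← Matrix.mul_assoc, Matrix.mul_nonsing_inv _ hdet, Matrix.one_mul]
  have key : Matrix.fromBlocks (C + Ψ) Ψ Ψ (D + Ψ) =
      Matrix.fromBlocks 1 1 0 1 * Matrix.fromBlocks (C * Ψ⁻¹ * D + C + D) C 0 Ψ *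
        (Matrix.fromBlocks 1 (-1) 0 1 * Matrix.fromBlocks 1 0 1 1 *
          Matrix.fromBlocks 1 (Ψ⁻¹ * D) 0 1) := by
    simp only [Matrix.fromBlocks_multiply, Matrix.mul_one, Matrix.one_mul, Matrix.mul_zero,
      Matrix.zero_mul, add_zero, zero_add, add_neg_cancel, Matrix.mul_neg, Matrix.mul_add,
      Matrix.add_mul, hcancel, Matrix.mul_assoc]
    congr 1
    · abel
    · simp
  rw [key]
  simp only [Matrix.det_mul, Matrix.det_fromBlocks_zero₂₁, Matrix.det_fromBlocks_zero₁₂,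
    Matrix.det_one]
  ring
end

section
/- Let n be a natural number, let C₂ and C₃ be arbitrary n×n complex matrices, and let Ψ be an invertible n×n complex matrix. Then the determinant of the 2n×2n block matrix with blocks [[Ψ, Ψ + C₃], [Ψ + C₂, Ψ]] equals (−1)ⁿ · det(Ψ) · det(C₂ + C₃ + C₂·Ψ⁻¹·C₃). -/
open Matrix

/-- Appendix A determinant identity (Eqn. (maxi_psis)):
`det [[Ψ, Ψ+C₃], [Ψ+C₂, Ψ]] = (−1)ⁿ · det Ψ · det (C₂ + C₃ + C₂·Ψ⁻¹·C₃)`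
for invertible `Ψ`. -/
theorem stmt_5 {n : ℕ} (C₂ C₃ Ψ : Matrix (Fin n) (Fin n) ℂ) (hΨ : IsUnit Ψ) :
    (Matrix.fromBlocks Ψ (Ψ + C₃) (Ψ + C₂) Ψ).det =
      (-1 : ℂ) ^ n * Ψ.det * (C₂ + C₃ + C₂ * Ψ⁻¹ * C₃).det := by
  have hd : IsUnit Ψ.det := (Matrix.isUnit_iff_isUnit_det Ψ).mp hΨ
  have h1 : Ψ * Ψ⁻¹ = 1 := Matrix.mul_nonsing_inv Ψ hd
  have h2 : Ψ⁻¹ * Ψ = 1 := Matrix.nonsing_inv_mul Ψ hd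
  letI : Invertible Ψ := hΨ.invertible
  have key : Ψ - (Ψ + C₂) * Ψ⁻¹ * (Ψ + C₃) = -(C₂ + C₃ + C₂ * Ψ⁻¹ * C₃) := by
    have h3 : C₂ * Ψ⁻¹ * Ψ = C₂ := by rw [Matrix.mul_assoc, h2, Matrix.mul_one]
    rw [Matrix.add_mul, h1, Matrix.add_mul, Matrix.one_mul, Matrix.mul_add, h3]
    abel
  rw [Matrix.det_fromBlocks₁₁, Matrix.invOf_eq_nonsing_inv, key, Matrix.det_neg,
    Fintype.card_fin]
  ring
end

section
/- Let a_SR, a_SD, a_RD, P_t be real numbers with 0 < a_SD ≤ a_SR, a_RD > 0 and P_t > 0. Define h(P₁) = min{log(1 + a_SR·P₁), log(1 + a_SD·P₁ + (a_SD + a_RD)·(P_t − P₁))} for P₁ ∈ [0, P_t]. Then any P₁* ∈ [0, P_t] at which h attains its maximum over [0, P_t] satisfies log(1 + a_SR·P₁*) = log(1 + a_SD·P₁* + (a_SD + a_RD)·(P_t − P₁*)); that is, the two rate terms are equal at any maximizer. -/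
/-- Degraded case (`a_SD ≤ a_SR`) of the DF power-allocation lemma (Appendix D):
at any maximizer of `h(P₁) = min{log(1 + a_SR·P₁), log(1 + a_SD·P₁ + (a_SD+a_RD)(P_t−P₁))}`
over `[0, P_t]`, the two rate terms coincide. -/
theorem stmt_8 (aSR aSD aRD Pt : ℝ)
    (haSD : 0 < aSD) (hle : aSD ≤ aSR) (haRD : 0 < aRD) (hPt : 0 < Pt)
    (h : ℝ → ℝ)
    (hh : ∀ P₁, h P₁ = min (Real.log (1 + aSR * P₁))
        (Real.log (1 + aSD * P₁ + (aSD + aRD) * (Pt - P₁))))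
    (P₁s : ℝ) (hmem : P₁s ∈ Set.Icc (0 : ℝ) Pt)
    (hmax : ∀ P₁ ∈ Set.Icc (0 : ℝ) Pt, h P₁ ≤ h P₁s) :
    Real.log (1 + aSR * P₁s) =
      Real.log (1 + aSD * P₁s + (aSD + aRD) * (Pt - P₁s)) := by
  have hSR : 0 < aSR := lt_of_lt_of_le haSD hle
  have hd : 0 < aSR + aRD := by linarith
  obtain ⟨h0, h1⟩ := hmem
  obtain ⟨c, hc⟩ : ∃ c, c = (aSD + aRD) * Pt / (aSR + aRD) := ⟨_, rfl⟩
  have hc' : c * (aSR + aRD) = (aSD + aRD) * Pt := by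
    rw [hc]; field_simp
  have hc0 : 0 < c := by rw [hc]; positivity
  have hc1 : c ≤ Pt := by
    rw [hc, div_le_iff₀ hd]; nlinarith
  have heq : 1 + aSD * c + (aSD + aRD) * (Pt - c) = 1 + aSR * c := by linarith
  have hm := hmax c ⟨hc0.le, hc1⟩
  rw [hh, hh, heq, min_self] at hm
  have hA := hm.trans (min_le_left _ _)
  have hB := hm.trans (min_le_right _ _)
  have hpc : 0 < aSR * c := by positivity
  have hp1 : 0 ≤ aSR * P₁s := by positivity
  have hp2 : 0 ≤ aSD * P₁s := by positivity
  have hp3 : 0 ≤ (aSD + aRD) * (Pt - P₁s) :=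
    mul_nonneg (by linarith) (by linarith)
  rw [Real.log_le_log_iff (by linarith) (by linarith)] at hA hB
  have e1 : c ≤ P₁s := by
    by_contra! hlt
    nlinarith
  have e2 : P₁s ≤ c := by
    by_contra! hlt
    nlinarith
  have e : P₁s = c := le_antisymm e2 e1
  rw [e, heq]
end

section
/- Let a_SR, a_SD, a_RD, P_t be real numbers with 0 < a_SD ≤ a_SR, a_RD > 0 and P_t ≥ 0. Set P₁* = (a_SD + a_RD)·P_t/(a_SR + a_RD). Then 0 ≤ P₁* ≤ P_t, the two quantities log(1 + a_SR·P₁*) and log(1 + a_SD·P₁* + (a_SD + a_RD)·(P_t − P₁*)) are equal, and for every P₁ ∈ [0, P_t], min{log(1 + a_SR·P₁), log(1 + a_SD·P₁ + (a_SD + a_RD)·(P_t − P₁))} ≤ log(1 + a_SR·P₁*). Hence the maximum over P₁ ∈ [0, P_t] of this minimum equals log(1 + a_SR·(a_SD + a_RD)·P_t/(a_SR + a_RD)). -/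
/-- Degraded case (`a_SD ≤ a_SR`) of the DF power-allocation theorem (Section V.A):
with `P₁* = (a_SD + a_RD)·P_t/(a_SR + a_RD)` one has `P₁* ∈ [0, P_t]`, the two rate
terms are equal at `P₁*`, the min of the two rate terms is at most `log(1 + a_SR·P₁*)`
on `[0, P_t]`, and the max-min equals `log(1 + a_SR·(a_SD + a_RD)·P_t/(a_SR + a_RD))`. -/
theorem stmt_9 (aSR aSD aRD Pt : ℝ)
    (haSD : 0 < aSD) (hle : aSD ≤ aSR) (haRD : 0 < aRD) (hPt : 0 ≤ Pt)
    (P₁s : ℝ) (hP₁s : P₁s = (aSD + aRD) * Pt / (aSR + aRD)) :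
    (0 ≤ P₁s ∧ P₁s ≤ Pt) ∧
    Real.log (1 + aSR * P₁s) =
      Real.log (1 + aSD * P₁s + (aSD + aRD) * (Pt - P₁s)) ∧
    (∀ P₁ ∈ Set.Icc (0 : ℝ) Pt,
        min (Real.log (1 + aSR * P₁))
            (Real.log (1 + aSD * P₁ + (aSD + aRD) * (Pt - P₁))) ≤
          Real.log (1 + aSR * P₁s)) ∧
    IsGreatest {y : ℝ | ∃ P₁ ∈ Set.Icc (0 : ℝ) Pt,
        y = min (Real.log (1 + aSR * P₁))
            (Real.log (1 + aSD * P₁ + (aSD + aRD) * (Pt - P₁)))}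
      (Real.log (1 + aSR * ((aSD + aRD) * Pt / (aSR + aRD)))) := by
  have hSR : 0 < aSR := lt_of_lt_of_le haSD hle
  have hs : 0 < aSR + aRD := by linarith
  have hmul : P₁s * (aSR + aRD) = (aSD + aRD) * Pt := by
    rw [hP₁s]; field_simp
  rw [← hP₁s]
  have h0 : 0 ≤ P₁s := by
    rw [hP₁s]; positivity
  have h1 : P₁s ≤ Pt := by
    rw [hP₁s, div_le_iff₀ hs]; nlinarith
  have heq : 1 + aSR * P₁s = 1 + aSD * P₁s + (aSD + aRD) * (Pt - P₁s) := by
    linarith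
  have hub : ∀ P₁ ∈ Set.Icc (0 : ℝ) Pt,
        min (Real.log (1 + aSR * P₁))
            (Real.log (1 + aSD * P₁ + (aSD + aRD) * (Pt - P₁))) ≤
          Real.log (1 + aSR * P₁s) := by
    rintro P ⟨hP0, hP1⟩
    rcases le_total P P₁s with h | h
    · refine (min_le_left _ _).trans (Real.log_le_log (by positivity) ?_)
      have := mul_le_mul_of_nonneg_left h hSR.le
      linarith
    · refine (min_le_right _ _).trans (Real.log_le_log ?_ ?_)
      · have : 0 ≤ Pt - P := by linarith
        positivity
      · rw [heq]
        have := mul_le_mul_of_nonneg_left h haRD.le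
        linarith
  refine ⟨⟨h0, h1⟩, by rw [heq], hub, ⟨P₁s, ⟨h0, h1⟩, ?_⟩, ?_⟩
  · rw [← heq, min_self]
  · rintro y ⟨P, hP, rfl⟩
    exact hub P hP
end

section
/- Let P_S, P_R, N₁, N₂, W be positive reals, set N = N₁ + N₂, and for α ∈ [0,1] define f(α) = W·log(1 + α·P_S/(N₁·W)) and g(α) = W·log(1 + (P_S + P_R + 2·√((1 − α)·P_S·P_R))/(N·W)). If P_S/N₁ ≤ P_R/N₂, then min{f(1), g(1)} = f(1) and for every α ∈ [0,1], min{f(α), g(α)} ≤ f(1); hence the maximum over α ∈ [0,1] of min{f(α), g(α)} equals W·log(1 + P_S/(N₁·W)), attained at α = 1. -/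
/-- First case of the equal-bandwidth example (Section VI.A): if `P_S/N₁ ≤ P_R/N₂`
then `α = 1` is optimal, and the capacity `max_{α∈[0,1]} min{f(α), g(α)}` equals
`W·log(1 + P_S/(N₁·W))`. -/
theorem stmt_12 (PS PR N₁ N₂ W : ℝ)
    (hPS : 0 < PS) (hPR : 0 < PR) (hN₁ : 0 < N₁) (hN₂ : 0 < N₂) (hW : 0 < W)
    (f g : ℝ → ℝ)
    (hf : ∀ α, f α = W * Real.log (1 + α * PS / (N₁ * W)))
    (hg : ∀ α, g α = W * Real.log (1 +
        (PS + PR + 2 * Real.sqrt ((1 - α) * PS * PR)) / ((N₁ + N₂) * W)))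
    (hcond : PS / N₁ ≤ PR / N₂) :
    min (f 1) (g 1) = f 1 ∧
    (∀ α ∈ Set.Icc (0 : ℝ) 1, min (f α) (g α) ≤ f 1) ∧
    IsGreatest {y : ℝ | ∃ α ∈ Set.Icc (0 : ℝ) 1, y = min (f α) (g α)}
      (W * Real.log (1 + PS / (N₁ * W))) := by
  have h1 : f 1 = W * Real.log (1 + PS / (N₁ * W)) := by rw [hf, one_mul]
  have hc : PS * N₂ ≤ PR * N₁ := (div_le_div_iff₀ hN₁ hN₂).1 hcond
  have hmin : min (f 1) (g 1) = f 1 := by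
    apply min_eq_left
    rw [h1, hg]
    have e : (1 - (1 : ℝ)) * PS * PR = 0 := by ring
    rw [e, Real.sqrt_zero]
    have key : PS / (N₁ * W) ≤ (PS + PR + 2 * 0) / ((N₁ + N₂) * W) := by
      rw [div_le_div_iff₀ (by positivity) (by positivity)]
      nlinarith [mul_le_mul_of_nonneg_right hc hW.le]
    have hp : 0 < 1 + PS / (N₁ * W) := by positivity
    exact mul_le_mul_of_nonneg_left (Real.log_le_log hp (by linarith)) hW.le
  have hle : ∀ α ∈ Set.Icc (0 : ℝ) 1, min (f α) (g α) ≤ f 1 := by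
    rintro α ⟨h0, hα⟩
    refine (min_le_left _ _).trans ?_
    rw [hf, hf]
    have key : α * PS / (N₁ * W) ≤ 1 * PS / (N₁ * W) := by gcongr
    have hp : 0 < 1 + α * PS / (N₁ * W) := by positivity
    exact mul_le_mul_of_nonneg_left (Real.log_le_log hp (by linarith)) hW.le
  refine ⟨hmin, hle, ⟨1, ⟨zero_le_one, le_refl _⟩, ?_⟩, ?_⟩
  · rw [hmin, h1]
  · rintro y ⟨α, hα, rfl⟩
    rw [← h1]
    exact hle α hα
end

section
/- Let P_S, P_R, N₁, N₂, W be positive reals, set N = N₁ + N₂, and for α ∈ [0,1] define f(α) = W·log(1 + α·P_S/(N₁·W)) and g(α) = W·log(1 + (P_S + P_R + 2·√((1 − α)·P_S·P_R))/(N·W)). If P_S/N₁ > P_R/N₂, then there exists a unique α* ∈ (0,1) with f(α*) = g(α*) (equivalently, α*·P_S/N₁ = (P_S + P_R + 2·√((1 − α*)·P_S·P_R))/N), and for every α ∈ [0,1], min{f(α), g(α)} ≤ f(α*); hence the maximum over α ∈ [0,1] of min{f(α), g(α)} equals W·log(1 + α*·P_S/(N₁·W)). -/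
/-- Second case of the equal-bandwidth example (Section VI.A): if `P_S/N₁ > P_R/N₂`
then there is a unique `α* ∈ (0,1)` with `f(α*) = g(α*)`, the min of `f` and `g` is
at most `f(α*)` on `[0,1]`, and the capacity `max_{α∈[0,1]} min{f(α), g(α)}` equals
`W·log(1 + α*·P_S/(N₁·W))`. -/
theorem stmt_13 (PS PR N₁ N₂ W : ℝ)
    (hPS : 0 < PS) (hPR : 0 < PR) (hN₁ : 0 < N₁) (hN₂ : 0 < N₂) (hW : 0 < W)
    (f g : ℝ → ℝ)
    (hf : ∀ α, f α = W * Real.log (1 + α * PS / (N₁ * W)))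
    (hg : ∀ α, g α = W * Real.log (1 +
        (PS + PR + 2 * Real.sqrt ((1 - α) * PS * PR)) / ((N₁ + N₂) * W)))
    (hcond : PR / N₂ < PS / N₁) :
    ∃ αs ∈ Set.Ioo (0 : ℝ) 1,
      f αs = g αs ∧
      (∀ α' ∈ Set.Ioo (0 : ℝ) 1, f α' = g α' → α' = αs) ∧
      (∀ α ∈ Set.Icc (0 : ℝ) 1, min (f α) (g α) ≤ f αs) ∧
      IsGreatest {y : ℝ | ∃ α ∈ Set.Icc (0 : ℝ) 1, y = min (f α) (g α)}
        (W * Real.log (1 + αs * PS / (N₁ * W))) := by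
  have hN : 0 < N₁ + N₂ := by positivity
  have hc : PR * N₁ < PS * N₂ := (div_lt_div_iff₀ hN₂ hN₁).mp hcond
  have hfm : ∀ a b : ℝ, 0 ≤ a → a < b → f a < f b := by
    intro a b ha hab
    rw [hf, hf]
    have h1 : 0 ≤ a * PS / (N₁ * W) := by positivity
    have h2 : a * PS / (N₁ * W) < b * PS / (N₁ * W) := by gcongr
    exact mul_lt_mul_of_pos_left (Real.log_lt_log (by linarith) (by linarith)) hW
  have hgm : ∀ a b : ℝ, a ≤ b → g b ≤ g a := by
    intro a b hab
    rw [hg, hg]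
    have h2 : Real.sqrt ((1 - b) * PS * PR) ≤ Real.sqrt ((1 - a) * PS * PR) := by
      gcongr
    gcongr
  have hfc : ContinuousOn f (Set.Icc 0 1) := by
    have : f = fun α => W * Real.log (1 + α * PS / (N₁ * W)) := funext hf
    rw [this]
    refine ContinuousOn.mul continuousOn_const (ContinuousOn.log (by fun_prop) ?_)
    intro x hx
    have h0 := hx.1
    positivity
  have hgc : ContinuousOn g (Set.Icc 0 1) := by
    have : g = fun α => W * Real.log (1 +
        (PS + PR + 2 * Real.sqrt ((1 - α) * PS * PR)) / ((N₁ + N₂) * W)) := funext hg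
    rw [this]
    refine ContinuousOn.mul continuousOn_const (ContinuousOn.log (by fun_prop) ?_)
    intro x hx
    positivity
  have h0 : f 0 < g 0 := by
    rw [hf, hg]
    refine mul_lt_mul_of_pos_left (Real.log_lt_log (by simp) ?_) hW
    have : 0 < (PS + PR + 2 * Real.sqrt ((1 - 0) * PS * PR)) / ((N₁ + N₂) * W) := by
      positivity
    simpa using this
  have h1 : g 1 < f 1 := by
    rw [hf, hg]
    refine mul_lt_mul_of_pos_left (Real.log_lt_log (by positivity) ?_) hW
    have : (PS + PR) / ((N₁ + N₂) * W) < PS / (N₁ * W) := by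
      rw [div_lt_div_iff₀ (by positivity) (by positivity)]
      nlinarith [mul_lt_mul_of_pos_right hc hW]
    simpa using this
  obtain ⟨c, hcI, hce⟩ := intermediate_value_Ioo (zero_le_one' ℝ) (hfc.sub hgc)
    (show (0 : ℝ) ∈ Set.Ioo (f 0 - g 0) (f 1 - g 1) from ⟨by linarith, by linarith⟩)
  have hce' : f c = g c := by
    have : f c - g c = 0 := hce
    linarith
  have hmax : ∀ α ∈ Set.Icc (0 : ℝ) 1, min (f α) (g α) ≤ f c := by
    intro α hα
    rcases lt_or_ge α c with h | h
    · exact (min_le_left _ _).trans (hfm α c hα.1 h).le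
    · exact (min_le_right _ _).trans ((hgm c α h).trans hce'.ge)
  refine ⟨c, hcI, hce', ?_, hmax, ?_, ?_⟩
  · intro a ha hae
    rcases lt_trichotomy a c with h | h | h
    · linarith [hfm a c ha.1.le h, hgm a c h.le]
    · exact h
    · linarith [hfm c a hcI.1.le h, hgm c a h.le]
  · exact ⟨c, ⟨hcI.1.le, hcI.2.le⟩, by rw [← hce', min_self, hf]⟩
  · rintro y ⟨α, hα, rfl⟩
    rw [← hf]
    exact hmax α hα
end

section
/- Let n be a natural number and let A, B, C, D, E, F, G, H be diagonal n×n complex matrices. Let M = fromBlocks A B C D and N = fromBlocks E F G H be the corresponding 2n×2n matrices. Then det(I_{2n} + M·N) = ∏_{i=1}^{n} det(I₂ + Mᵢ·Nᵢ), where Mᵢ = [[Aᵢᵢ, Bᵢᵢ], [Cᵢᵢ, Dᵢᵢ]] and Nᵢ = [[Eᵢᵢ, Fᵢᵢ], [Gᵢᵢ, Hᵢᵢ]] are the 2×2 matrices of i-th diagonal entries. -/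
open Matrix

/-- Interleaving: a block matrix with diagonal blocks has as determinant the product of
the `2×2` determinants of the diagonal entries. -/
theorem det_fromBlocks_diagonal_aux {n : ℕ} (a b c d : Fin n → ℂ) :
    (fromBlocks (diagonal a) (diagonal b) (diagonal c) (diagonal d)).det =
      ∏ i : Fin n, (!![a i, b i; c i, d i] : Matrix (Fin 2) (Fin 2) ℂ).det := by
  let e : Fin n ⊕ Fin n ≃ Fin 2 × Fin n :=
    { toFun := Sum.elim (fun i => (0, i)) (fun i => (1, i))
      invFun := fun p => if p.1 = 0 then Sum.inl p.2 else Sum.inr p.2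
      left_inv := by rintro (i | i) <;> simp
      right_inv := by rintro ⟨j, i⟩; fin_cases j <;> simp }
  rw [← det_blockDiagonal, ← det_submatrix_equiv_self e]
  congr 1
  ext (i | i) (j | j) <;>
    simp [e, blockDiagonal_apply, diagonal_apply]

/-- Channel-decoupling computation from the proof of Theorem 2: if all eight blocks
are diagonal, then `det(I_{2n} + M·N)` with `M = fromBlocks A B C D` and
`N = fromBlocks E F G H` factors into the product of the `n` per-sub-band `2×2`
determinants. -/
theorem stmt_14 {n : ℕ} (A B C D E F G H : Matrix (Fin n) (Fin n) ℂ)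
    (hA : A.IsDiag) (hB : B.IsDiag) (hC : C.IsDiag) (hD : D.IsDiag)
    (hE : E.IsDiag) (hF : F.IsDiag) (hG : G.IsDiag) (hH : H.IsDiag) :
    ((1 : Matrix (Fin n ⊕ Fin n) (Fin n ⊕ Fin n) ℂ) +
        fromBlocks A B C D * fromBlocks E F G H).det =
      ∏ i : Fin n,
        ((1 : Matrix (Fin 2) (Fin 2) ℂ) +
          !![A i i, B i i; C i i, D i i] * !![E i i, F i i; G i i, H i i]).det := by
  rw [← hA.diagonal_diag, ← hB.diagonal_diag, ← hC.diagonal_diag, ← hD.diagonal_diag,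
    ← hE.diagonal_diag, ← hF.diagonal_diag, ← hG.diagonal_diag, ← hH.diagonal_diag,
    fromBlocks_multiply, ← fromBlocks_one, fromBlocks_add]
  simp only [diagonal_mul_diagonal, diagonal_add, ← diagonal_one, zero_add]
  rw [det_fromBlocks_diagonal_aux]
  refine Finset.prod_congr rfl fun i _ => ?_
  simp [det_fin_two]
end
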